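/- For any real l, ‖φ‖_{H^{2,l}} ≃ ‖⟨x⟩^l φ‖_{L²} + ‖⟨x⟩^l Δφ‖_{L²} for φ in the weighted Sobolev space H^{2,l}(ℝ³). -/

import Mathlib

open MeasureTheory ENNReal

/-- Physical space `ℝ³`. -/
abbrev E3 : Type := EuclideanSpace ℝ (Fin 3)

/-- The `H²` norm: `‖f‖₂ + ‖Df‖₂ + ‖D²f‖₂` (as an extended nonnegative real). -/
noncomputable def H2norm (f : E3 → ℂ) : ℝ≥0∞ :=
  eLpNorm f 2 volume + eLpNorm (fun x => ‖iteratedFDeriv ℝ 1 f x‖) 2 volume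
    + eLpNorm (fun x => ‖iteratedFDeriv ℝ 2 f x‖) 2 volume

/-- The Laplacian `Δf = ∑ᵢ ∂²f/∂xᵢ²`. -/
noncomputable def lap (f : E3 → ℂ) (x : E3) : ℂ :=
  ∑ i : Fin 3,
    iteratedFDeriv ℝ 2 f x ![EuclideanSpace.single i 1, EuclideanSpace.single i 1]

/-- The `W^{2,1}` norm: `‖f‖_{L¹} + ‖Δf‖_{L¹}`. -/
noncomputable def W21norm (f : E3 → ℂ) : ℝ≥0∞ :=
  eLpNorm f 1 volume + eLpNorm (lap f) 1 volume

/-- The weighted `H^{2,l}` norm: `‖⟨x⟩^l f‖_{H²}` with `⟨x⟩ = √(1+|x|²)`. -/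
noncomputable def H2wnorm (l : ℝ) (f : E3 → ℂ) : ℝ≥0∞ :=
  H2norm (fun x => (((1 + ‖x‖ ^ 2) ^ (l / 2) : ℝ) : ℂ) * f x)

noncomputable abbrev ee (i : Fin 3) : E3 := EuclideanSpace.single i (1:ℝ)

noncomputable def DD {F : Type*} [NormedAddCommGroup F] [NormedSpace ℝ F] (v : E3) (f : E3 → F) (x : E3) : F :=
  fderiv ℝ f x v

section
variable {F : Type*} [NormedAddCommGroup F] [NormedSpace ℝ F]

lemma DD_contDiff {f : E3 → F} {n : ℕ∞} {v : E3} (hf : ContDiff ℝ (n+1) f) : ContDiff ℝ n (DD v f) := by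
  unfold DD
  exact (hf.fderiv_right le_rfl).clm_apply contDiff_const

lemma DD_cont {f : E3 → F} {v : E3} (hf : ContDiff ℝ 1 f) : Continuous (DD v f) := by
  have := DD_contDiff (n := 0) (v := v) (f := f) (by simpa using hf)
  exact this.continuous

lemma DD_one {f : E3 → F} {v : E3} (hf : ContDiff ℝ 2 f) : ContDiff ℝ 1 (DD v f) := by
  have := DD_contDiff (n := 1) (v := v) (f := f) (by norm_num; exact hf)
  simpa using this

lemma DD_supp {f : E3 → F} {v : E3} (hf : HasCompactSupport f) : HasCompactSupport (DD v f) := by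
  unfold DD
  exact hf.fderiv_apply ℝ v

lemma DD_smul {a : E3 → ℝ} {f : E3 → F} {v : E3} (ha : ContDiff ℝ 1 a) (hf : ContDiff ℝ 1 f) :
    DD v (fun x => a x • f x) = fun x => DD v a x • f x + a x • DD v f x := by
  ext x
  unfold DD
  rw [fderiv_fun_smul (ha.differentiable (by simp) x) (hf.differentiable (by simp) x)]
  simp [add_comm]

lemma DD_add {g : E3 → F} {f : E3 → F} {v : E3} (ha : ContDiff ℝ 1 g) (hf : ContDiff ℝ 1 f) :
    DD v (fun x => g x + f x) = fun x => DD v g x + DD v f x := by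
  ext x
  unfold DD
  rw [fderiv_fun_add (ha.differentiable (by simp) x) (hf.differentiable (by simp) x)]
  simp

lemma DD2_smul {a : E3 → ℝ} {f : E3 → F} {u v : E3} (ha : ContDiff ℝ 2 a) (hf : ContDiff ℝ 2 f) :
    DD u (DD v (fun x => a x • f x)) = fun x => DD u (DD v a) x • f x + DD v a x • DD u f x
      + (DD u a x • DD v f x + a x • DD u (DD v f) x) := by
  have ha1 : ContDiff ℝ 1 a := ha.of_le (by norm_num)
  have hf1 : ContDiff ℝ 1 f := hf.of_le (by norm_num)
  rw [DD_smul ha1 hf1, DD_add (g := fun x => DD v a x • f x) (f := fun x => a x • DD v f x) ((DD_one ha).smul hf1)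
      (ha1.smul (DD_one hf)),
    DD_smul (DD_one ha) hf1, DD_smul ha1 (DD_one hf)]

lemma DD_comm {f : E3 → F} {u v : E3} (hf : ContDiff ℝ 2 f) : DD u (DD v f) = DD v (DD u f) := by
  have hd : Differentiable ℝ (fderiv ℝ f) :=
    (hf.fderiv_right (m := 1) (by norm_num)).differentiable (by simp)
  ext x
  have h := hf.contDiffAt (x := x) |>.isSymmSndFDerivAt (by simp)
  have key : ∀ u v : E3, DD u (DD v f) x = fderiv ℝ (fderiv ℝ f) x u v := by
    intro u v
    unfold DD
    rw [fderiv_clm_apply (hd x) (by fun_prop)]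
    simp
  rw [key, key]
  exact h.eq _ _

lemma iter2 {f : E3 → F} (hf : ContDiff ℝ 2 f) (x u v : E3) :
    iteratedFDeriv ℝ 2 f x ![u, v] = DD u (DD v f) x := by
  have hd : Differentiable ℝ (fderiv ℝ f) :=
    (hf.fderiv_right (m := 1) (by norm_num)).differentiable (by simp)
  rw [iteratedFDeriv_two_apply]
  unfold DD
  rw [fderiv_clm_apply (hd x) (by fun_prop)]
  simp

lemma norm_DD_le (f : E3 → F) (i : Fin 3) (x : E3) : ‖DD (ee i) f x‖ ≤ ‖iteratedFDeriv ℝ 1 f x‖ := by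
  rw [norm_iteratedFDeriv_one]
  simpa [ee, DD] using (fderiv ℝ f x).le_opNorm (ee i)

lemma norm_DD2_le {f : E3 → F} (hf : ContDiff ℝ 2 f) (i j : Fin 3) (x : E3) :
    ‖DD (ee i) (DD (ee j) f) x‖ ≤ ‖iteratedFDeriv ℝ 2 f x‖ := by
  rw [← iter2 hf]
  simpa [Fin.prod_univ_two] using (iteratedFDeriv ℝ 2 f x).le_opNorm ![ee i, ee j]

lemma clm_bound (L : E3 →L[ℝ] F) : ‖L‖ ≤ ∑ i, ‖L (ee i)‖ := by
  refine L.opNorm_le_bound (by positivity) fun y => ?_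
  have : y = ∑ i, y i • ee i := by
    ext k; simp [ee, Fin.sum_univ_three]; fin_cases k <;> simp
  conv_lhs => rw [this]
  rw [map_sum, Finset.sum_mul]
  refine (norm_sum_le _ _).trans (Finset.sum_le_sum fun i _ => ?_)
  rw [map_smul, norm_smul, mul_comm]
  gcongr
  exact EuclideanSpace.norm_eq y ▸ (PiLp.norm_apply_le y i)

lemma iter1_le (f : E3 → F) (x : E3) : ‖iteratedFDeriv ℝ 1 f x‖ ≤ ∑ i, ‖DD (ee i) f x‖ := by
  rw [norm_iteratedFDeriv_one]; exact clm_bound _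

lemma iter2_le {f : E3 → F} (hf : ContDiff ℝ 2 f) (x : E3) :
    ‖iteratedFDeriv ℝ 2 f x‖ ≤ ∑ i, ∑ j, ‖DD (ee i) (DD (ee j) f) x‖ := by
  have hd : Differentiable ℝ (fderiv ℝ f) :=
    (hf.fderiv_right (m := 1) (by norm_num)).differentiable (by simp)
  have : ‖iteratedFDeriv ℝ 2 f x‖ ≤ ‖fderiv ℝ (fderiv ℝ f) x‖ := by
    refine ContinuousMultilinearMap.opNorm_le_bound (by positivity) fun m => ?_
    rw [iteratedFDeriv_two_apply, Fin.prod_univ_two, ← mul_assoc]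
    exact (fderiv ℝ (fderiv ℝ f) x).le_opNorm₂ _ _
  refine this.trans ?_
  refine (clm_bound _).trans (Finset.sum_le_sum fun i _ => (clm_bound _).trans (Finset.sum_le_sum fun j _ => ?_))
  rw [← iter2 hf, iteratedFDeriv_two_apply]; simp

end

/-! Integration by parts -/

lemma intg {f g : E3 → ℂ} (hf : Continuous f) (hg : Continuous g) (hs : HasCompactSupport f) :
    Integrable (fun x => inner ℝ (f x) (g x)) (volume : Measure E3) := by
  refine (hf.inner hg).integrable_of_hasCompactSupport ?_
  refine hs.mono' (fun x hx => ?_)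
  apply subset_closure
  intro h
  apply hx
  simp [h]

lemma intg' {f g : E3 → ℂ} (hf : Continuous f) (hg : Continuous g) (hs : HasCompactSupport g) :
    Integrable (fun x => inner ℝ (f x) (g x)) (volume : Measure E3) := by
  simpa only [real_inner_comm] using intg hg hf hs

lemma ibp {f g : E3 → ℂ} {v : E3} (hf : ContDiff ℝ 1 f) (hg : ContDiff ℝ 1 g)
    (hs : HasCompactSupport f) :
    ∫ x, inner ℝ (f x) (DD v g x) = - ∫ x, inner ℝ (DD v f x) (g x) := by
  have := integral_bilinear_fderiv_right_eq_neg_left_of_integrable (μ := (volume : Measure E3))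
    (f := f) (g := g) (v := v) (B := innerSL ℝ)
    (intg (DD_cont (v := v) hf) hg.continuous (DD_supp hs))
    (intg hf.continuous (DD_cont (v := v) hg) hs)
    (intg hf.continuous hg.continuous hs)
    (fun x _ => hf.differentiable (by simp) x) (fun x _ => hg.differentiable (by simp) x)
  exact this

lemma param {h k : E3 → ℂ} {v : E3} (hh : Continuous h) (hk : ContDiff ℝ 1 k)
    (hs : HasCompactSupport h) (hs' : HasCompactSupport k) :
    HasDerivAt (fun t : ℝ => ∫ x, inner ℝ (h x) (k (x + t • v)))
      (∫ x, inner ℝ (h x) (DD v k x)) 0 := by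
  obtain ⟨M, hM⟩ := (DD_supp (v := v) hs').exists_bound_of_continuous (DD_cont hk)
  have := hasDerivAt_integral_of_dominated_loc_of_deriv_le (𝕜 := ℝ) (μ := (volume : Measure E3))
    (F := fun t x => inner ℝ (h x) (k (x + t • v)))
    (F' := fun t x => inner ℝ (h x) (DD v k (x + t • v))) (x₀ := 0) (s := Set.univ)
    (bound := fun x => ‖h x‖ * M) Filter.univ_mem
    (Filter.Eventually.of_forall fun t => by
      have := hk.continuous
      exact Continuous.aestronglyMeasurable (by fun_prop))
    (by simpa using intg hh hk.continuous hs)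
    (by
      have := DD_cont (v := v) hk
      exact Continuous.aestronglyMeasurable (by fun_prop))
    (Filter.Eventually.of_forall fun x t _ => by
      refine (norm_inner_le_norm _ _).trans ?_
      gcongr
      exact hM _)
    ((hh.norm.integrable_of_hasCompactSupport hs.norm).mul_const _)
    (Filter.Eventually.of_forall fun x t _ => by
      have h1 : HasDerivAt (fun t : ℝ => x + t • v) v t := by
        simpa using ((hasDerivAt_id t).smul_const v).const_add x
      have h2 := ((hk.differentiable (by simp) (x + t • v)).hasFDerivAt).comp_hasDerivAt t h1
      simpa [DD] using (hasDerivAt_const t (h x)).inner ℝ h2)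
  simpa using this.2

lemma swap {f g : E3 → ℂ} {u v : E3} (hf : ContDiff ℝ 1 f) (hg : ContDiff ℝ 1 g)
    (hs : HasCompactSupport f) (hs' : HasCompactSupport g) :
    ∫ x, inner ℝ (DD u f x) (DD v g x) = ∫ x, inner ℝ (DD v f x) (DD u g x) := by
  have h1 := param (v := v) (DD_cont (v := u) hf) hg (DD_supp hs) hs'
  have h2 := param (v := -v) (DD_cont (v := u) hg) hf (DD_supp hs') hs
  have e : (fun t : ℝ => ∫ x, inner ℝ (DD u f x) (g (x + t • v)))
      = fun t : ℝ => - ∫ x, inner ℝ (DD u g x) (f (x + t • -v)) := by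
    ext t
    have hg' : ContDiff ℝ 1 (fun x => g (x + t • v)) := by fun_prop
    have := ibp (v := u) hf hg' hs
    have e2 : ∀ x, DD u (fun x => g (x + t • v)) x = DD u g (x + t • v) := by
      intro x; unfold DD; rw [fderiv_comp_add_right]
    simp only [e2] at this
    rw [← neg_eq_iff_eq_neg.mpr this]
    rw [← integral_add_right_eq_self (fun x => inner ℝ (DD u g x) (f (x + t • -v))) (t • v)]
    refine congrArg _ (integral_congr_ae (Filter.Eventually.of_forall fun x => ?_))
    simp only []
    rw [real_inner_comm]
    simp only [smul_neg, add_neg_cancel_right]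
  rw [e] at h1
  have h3 := h1.unique h2.neg
  rw [h3, ← integral_neg]
  congr 1; ext x
  rw [real_inner_comm]
  simp [DD]

/-! L² -/

lemma N_sq {f : E3 → ℂ} (hf : Continuous f) (hs : HasCompactSupport f) :
    eLpNorm f 2 volume ^ 2 = ENNReal.ofReal (∫ x, ‖f x‖ ^ 2) := by
  have hi : Integrable (fun x => ‖f x‖ ^ 2) (volume : Measure E3) := by
    simpa only [real_inner_self_eq_norm_sq] using intg hf hf hs
  rw [ofReal_integral_eq_lintegral_ofReal hi (Filter.Eventually.of_forall fun x => by positivity)]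
  have := eLpNorm_nnreal_pow_eq_lintegral (f := f) (p := 2) (μ := (volume : Measure E3)) (by simp)
  simp only [NNReal.coe_ofNat, ENNReal.rpow_ofNat, ENNReal.coe_ofNat] at this
  rw [this]
  congr 1; ext x
  simp [ENNReal.ofReal_pow]

/-- Laplacian in terms of `DD`. -/
noncomputable def LL (f : E3 → ℂ) (x : E3) : ℂ := ∑ i, DD (ee i) (DD (ee i) f) x

lemma LL_cont {f : E3 → ℂ} (hf : ContDiff ℝ 2 f) : Continuous (LL f) := by
  unfold LL
  exact continuous_finsetSum _ fun i _ => DD_cont (DD_one hf)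

lemma core2 {f : E3 → ℂ} (hf : ContDiff ℝ 2 f) (hs : HasCompactSupport f) (i j : Fin 3) :
    eLpNorm (DD (ee i) (DD (ee j) f)) 2 volume ≤ eLpNorm (LL f) 2 volume := by
  have hLs : HasCompactSupport (LL f) := by
    have : LL f = fun x => DD (ee 0) (DD (ee 0) f) x + DD (ee 1) (DD (ee 1) f) x +
      DD (ee 2) (DD (ee 2) f) x := by ext x; simp [LL, Fin.sum_univ_three]
    rw [this]
    exact ((DD_supp (DD_supp hs)).add (DD_supp (DD_supp hs))).add (DD_supp (DD_supp hs))
  have hi : ∀ i j k l, Integrable (fun x => inner ℝ (DD (ee i) (DD (ee j) f) x)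
      (DD (ee k) (DD (ee l) f) x)) (volume : Measure E3) := fun i j k l =>
    intg (DD_cont (DD_one hf)) (DD_cont (DD_one hf)) (DD_supp (DD_supp hs))
  have h1 : ∫ x, ‖LL f x‖ ^ 2 = ∑ i, ∑ j, ∫ x, ‖DD (ee i) (DD (ee j) f) x‖ ^ 2 := by
    have : ∀ x, ‖LL f x‖ ^ 2 = ∑ i, ∑ j, inner ℝ (DD (ee i) (DD (ee i) f) x)
        (DD (ee j) (DD (ee j) f) x) := by
      intro x
      rw [← real_inner_self_eq_norm_sq, LL, sum_inner]
      simp_rw [inner_sum]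
    simp_rw [this]
    rw [integral_finsetSum _ fun i _ => integrable_finsetSum _ fun j _ => hi _ _ _ _]
    refine Finset.sum_congr rfl fun i _ => ?_
    rw [integral_finsetSum _ fun j _ => hi _ _ _ _]
    refine Finset.sum_congr rfl fun j _ => ?_
    rw [swap (DD_one hf) (DD_one hf) (DD_supp hs) (DD_supp hs)]
    congr 1; ext x
    rw [DD_comm (u := ee j) hf, real_inner_self_eq_norm_sq]
  rw [← ENNReal.pow_le_pow_left_iff (n := 2) (by simp), N_sq (DD_cont (DD_one hf)) (DD_supp (DD_supp hs)),
    N_sq (LL_cont hf) hLs, h1]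
  refine ENNReal.ofReal_le_ofReal ?_
  have hn : ∀ i j, 0 ≤ ∫ x, ‖DD (ee i) (DD (ee j) f) x‖ ^ 2 := fun i j =>
    integral_nonneg fun x => by positivity
  refine le_trans ?_ (Finset.single_le_sum (fun i _ => Finset.sum_nonneg fun j _ => hn i j) (Finset.mem_univ i))
  exact (Finset.single_le_sum (f := fun j => ∫ x, ‖DD (ee i) (DD (ee j) f) x‖ ^ 2) (fun j _ => hn i j) (Finset.mem_univ j))

lemma smul_supp {V : E3 → ℝ} {f : E3 → ℂ} (hs : HasCompactSupport V) :
    HasCompactSupport (fun x => V x • f x) := hs.smul_right (f' := f)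

lemma core1 {V : E3 → ℝ} {f : E3 → ℂ} (hV : ContDiff ℝ 1 V) (hf : ContDiff ℝ 2 f)
    (hs : HasCompactSupport V) (i : Fin 3) :
    eLpNorm (fun x => V x • DD (ee i) f x) 2 volume ≤
      eLpNorm (fun x => V x • f x) 2 volume + eLpNorm (fun x => V x • LL f x) 2 volume
      + 2 * ∑ i, eLpNorm (fun x => DD (ee i) V x • f x) 2 volume := by
  have hf1 : ContDiff ℝ 1 f := hf.of_le (by norm_num)
  have cV := hV.continuous
  have cf := hf.continuous
  have cL := LL_cont hf
  have cD : ∀ i, Continuous (DD (ee i) f) := fun i => DD_cont hf1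
  have cDV : ∀ i, Continuous (DD (ee i) V) := fun i => DD_cont hV
  have iD : ∀ i, Integrable (fun x => ‖V x • DD (ee i) f x‖ ^ 2) (volume : Measure E3) := fun i => by
    simpa only [real_inner_self_eq_norm_sq] using
      intg (f := fun x => V x • DD (ee i) f x) (g := fun x => V x • DD (ee i) f x)
        (by fun_prop) (by fun_prop) (smul_supp hs)
  have iDV : ∀ i, Integrable (fun x => ‖DD (ee i) V x • f x‖ ^ 2) (volume : Measure E3) := fun i => by
    simpa only [real_inner_self_eq_norm_sq] using
      intg (f := fun x => DD (ee i) V x • f x) (g := fun x => DD (ee i) V x • f x)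
        (by fun_prop) (by fun_prop) (smul_supp (DD_supp hs))
  have if0 : Integrable (fun x => ‖V x • f x‖ ^ 2) (volume : Measure E3) := by
    simpa only [real_inner_self_eq_norm_sq] using
      intg (f := fun x => V x • f x) (g := fun x => V x • f x)
        (by fun_prop) (by fun_prop) (smul_supp hs)
  have iL : Integrable (fun x => ‖V x • LL f x‖ ^ 2) (volume : Measure E3) := by
    simpa only [real_inner_self_eq_norm_sq] using
      intg (f := fun x => V x • LL f x) (g := fun x => V x • LL f x)
        (by fun_prop) (by fun_prop) (smul_supp hs)
  have iX : ∀ i, Integrable (fun x => inner ℝ (DD (ee i) V x • f x) (V x • DD (ee i) f x))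
      (volume : Measure E3) := fun i => intg (by fun_prop) (by fun_prop) (smul_supp (DD_supp hs))
  have iY : Integrable (fun x => inner ℝ (V x • f x) (V x • LL f x))
      (volume : Measure E3) := intg (by fun_prop) (by fun_prop) (smul_supp hs)
  have i2 : ∀ i, Integrable (fun x => inner ℝ (V x • V x • f x) (DD (ee i) (DD (ee i) f) x))
      (volume : Measure E3) := fun i => intg (by fun_prop) (DD_cont (DD_one hf)) (smul_supp hs)
  -- integrate by parts
  have h1 : ∀ i, ∫ x, inner ℝ (V x • V x • f x) (DD (ee i) (DD (ee i) f) x) =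
      - (2 * (∫ x, inner ℝ (DD (ee i) V x • f x) (V x • DD (ee i) f x))
        + ∫ x, ‖V x • DD (ee i) f x‖ ^ 2) := by
    intro i
    rw [ibp (f := fun x => V x • V x • f x) (hV.smul (hV.smul hf1)) (DD_one hf) (smul_supp (f := fun x => V x • f x) hs)]
    rw [← integral_const_mul, ← integral_add ((iX i).const_mul 2) (iD i)]
    congr 2; ext x
    rw [DD_smul (f := fun x => V x • f x) hV (hV.smul hf1), DD_smul hV hf1,
      ← real_inner_self_eq_norm_sq]
    simp only [inner_add_left, inner_smul_left, inner_smul_right, smul_add]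
    simp only [conj_trivial]
    ring
  have h2 : ∫ x, inner ℝ (V x • f x) (V x • LL f x) =
      ∑ i, ∫ x, inner ℝ (V x • V x • f x) (DD (ee i) (DD (ee i) f) x) := by
    rw [← integral_finsetSum _ fun i _ => i2 i]
    congr 1; ext x
    simp only [LL, inner_smul_left, inner_smul_right, inner_sum, Finset.mul_sum, conj_trivial]
  have h3 : ∑ i, ∫ x, ‖V x • DD (ee i) f x‖ ^ 2 ≤ ∫ x, ‖V x • f x‖ ^ 2 + ‖V x • LL f x‖ ^ 2
      + 4 * ∑ i, ‖DD (ee i) V x • f x‖ ^ 2 := by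
    simp_rw [h1] at h2
    have h4 : ∑ i, ∫ x, ‖V x • DD (ee i) f x‖ ^ 2 = 
       ∫ x, - 2 * inner ℝ (V x • f x) (V x • LL f x) - 4 * ∑ i, inner ℝ (DD (ee i) V x • f x) (V x • DD (ee i) f x)
         - ∑ i, ‖V x • DD (ee i) f x‖ ^ 2 := by
      have iZ : Integrable (fun x => -2 * inner ℝ (V x • f x) (V x • LL f x) -
          4 * ∑ i, inner ℝ (DD (ee i) V x • f x) (V x • DD (ee i) f x)) (volume : Measure E3) :=
        (iY.const_mul _).sub ((integrable_finsetSum _ fun i _ => iX i).const_mul _)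
      rw [integral_sub iZ
        (integrable_finsetSum _ fun i _ => iD i), integral_sub (iY.const_mul _) ((integrable_finsetSum _ fun i _ => iX i).const_mul _),
        integral_const_mul, integral_const_mul, integral_finsetSum _ fun i _ => iX i,
        integral_finsetSum _ fun i _ => iD i, h2]
      simp only [Fin.sum_univ_three]
      ring
    rw [h4]
    refine integral_mono ?_ ?_ fun x => ?_
    · exact ((iY.const_mul _).sub ((integrable_finsetSum _ fun i _ => iX i).const_mul _)).sub
        (integrable_finsetSum _ fun i _ => iD i)
    · exact (if0.add iL).add ((integrable_finsetSum _ fun i _ => iDV i).const_mul _)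
    · have q1 : ∀ a b : ℂ, - 2 * inner ℝ a b ≤ ‖a‖ ^ 2 + ‖b‖ ^ 2 := by
        intro a b
        have := norm_add_sq_real a b
        have := sq_nonneg ‖a + b‖
        linarith
      have q2 : ∀ a b : ℂ, - 4 * inner ℝ a b - ‖b‖ ^ 2 ≤ 4 * ‖a‖ ^ 2 := by
        intro a b
        have := q1 ((2:ℝ) • a) b
        rw [norm_smul, inner_smul_left] at this
        simp only [conj_trivial, mul_pow] at this
        norm_num at this ⊢
        linarith
      have a0 := q1 (V x • f x) (V x • LL f x)
      have a1 := fun i => q2 (DD (ee i) V x • f x) (V x • DD (ee i) f x)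
      have := a1 0
      have := a1 1
      have := a1 2
      simp only [Fin.sum_univ_three]
      linarith
  rw [← ENNReal.pow_le_pow_left_iff (n := 2) (by simp)]
  have hsq : eLpNorm (fun x => V x • f x) 2 volume ^ 2 + eLpNorm (fun x => V x • LL f x) 2 volume ^ 2
      + 4 * ∑ i, eLpNorm (fun x => DD (ee i) V x • f x) 2 volume ^ 2 = 
      ENNReal.ofReal (∫ x, ‖V x • f x‖ ^ 2 + ‖V x • LL f x‖ ^ 2
      + 4 * ∑ i, ‖DD (ee i) V x • f x‖ ^ 2) := by
    have nn : ∀ g : E3 → ℂ, 0 ≤ ∫ x, ‖g x‖ ^ 2 := fun g => integral_nonneg fun x => by positivity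
    have iZ : Integrable (fun x => ‖V x • f x‖ ^ 2 + ‖V x • LL f x‖ ^ 2) (volume : Measure E3) :=
      if0.add iL
    rw [integral_add iZ ((integrable_finsetSum _ fun i _ => iDV i).const_mul _),
      integral_add if0 iL, integral_const_mul, integral_finsetSum _ fun i _ => iDV i,
      ENNReal.ofReal_add (add_nonneg (nn _) (nn _)) (mul_nonneg (by norm_num) (Finset.sum_nonneg fun i _ => nn _)),
      ENNReal.ofReal_add (nn _) (nn _), ENNReal.ofReal_mul (by norm_num),
      ENNReal.ofReal_sum_of_nonneg (fun i _ => nn _),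
      N_sq (by fun_prop) (smul_supp hs), N_sq (by fun_prop) (smul_supp hs)]
    congr 2
    · simp
    · refine Finset.sum_congr rfl fun i _ => ?_
      rw [N_sq (by fun_prop) (smul_supp (DD_supp hs))]
  calc _ ≤ eLpNorm (fun x => V x • f x) 2 volume ^ 2 + eLpNorm (fun x => V x • LL f x) 2 volume ^ 2
      + 4 * ∑ i, eLpNorm (fun x => DD (ee i) V x • f x) 2 volume ^ 2 := by
        rw [hsq, N_sq (by fun_prop) (smul_supp hs)]
        refine ENNReal.ofReal_le_ofReal (le_trans ?_ h3)
        exact (Finset.single_le_sum (f := fun i => ∫ x, ‖V x • DD (ee i) f x‖ ^ 2)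
          (fun j _ => integral_nonneg fun x => by positivity) (Finset.mem_univ i))
    _ ≤ _ := by
        have gen : ∀ a b c d e : ℝ≥0∞, a ^ 2 + b ^ 2 + 4 * (c ^ 2 + d ^ 2 + e ^ 2) ≤ 
            (a + b + 2 * (c + d + e)) ^ 2 := by
          intro a b c d e
          have : (a + b + 2 * (c + d + e)) ^ 2 = a ^ 2 + b ^ 2 + 4 * (c ^ 2 + d ^ 2 + e ^ 2)
            + (2 * a * b + 4 * (a + b) * (c + d + e) + 8 * (c * d + d * e + c * e)) := by ring
          rw [this]; exact le_self_add
        simp only [Fin.sum_univ_three]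
        exact gen _ _ _ _ _

/-! Weights -/

/-- The weight. -/
noncomputable def wt (l : ℝ) (x : E3) : ℝ := (1 + ‖x‖ ^ 2) ^ (l / 2)

lemma base_pos (x : E3) : 0 < 1 + ‖x‖ ^ 2 := by positivity

lemma wt_pos (l : ℝ) (x : E3) : 0 < wt l x := Real.rpow_pos_of_pos (base_pos x) _

lemma wt_contDiff (l : ℝ) : ContDiff ℝ 2 (wt l) := by
  unfold wt
  refine ContDiff.rpow_const_of_ne ?_ fun x => (base_pos x).ne'
  exact contDiff_const.add (contDiff_norm_sq ℝ)

lemma wt_step (l : ℝ) (x : E3) : wt l x = (1 + ‖x‖ ^ 2) * wt (l - 2) x := by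
  unfold wt
  rw [show l / 2 = 1 + (l - 2) / 2 by ring, Real.rpow_add (base_pos x), Real.rpow_one]

lemma wt_mono (l : ℝ) (x : E3) : wt (l - 2) x ≤ wt l x := by
  rw [wt_step l]
  have := wt_pos (l - 2) x
  nlinarith [sq_nonneg ‖x‖]

lemma wt_inv (l : ℝ) (x : E3) : wt (-l) x * wt l x = 1 := by
  unfold wt
  rw [← Real.rpow_add (base_pos x)]
  simp [neg_div]

lemma DD_wt (l : ℝ) (v : E3) : DD v (wt l) = fun x => (l * inner ℝ x v) • wt (l - 2) x := by
  ext x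
  unfold DD
  have h1 : HasFDerivAt (fun x : E3 => 1 + ‖x‖ ^ 2) (2 • innerSL ℝ x) x :=
    ((hasStrictFDerivAt_norm_sq x).hasFDerivAt).const_add 1
  have h2 := h1.rpow_const (p := l / 2) (Or.inl (base_pos x).ne')
  have h3 : fderiv ℝ (wt l) x = _ := h2.fderiv
  rw [h3]
  simp only [wt, show (l - 2) / 2 = l / 2 - 1 by ring]
  simp
  ring

/-- `a` and its first two derivatives are bounded by `C w`. -/
structure WB (C : ℝ) (a w : E3 → ℝ) : Prop where
  zero : ∀ x, |a x| ≤ C * w x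
  one : ∀ i x, |DD (ee i) a x| ≤ C * w x
  two : ∀ i j x, |DD (ee i) (DD (ee j) a) x| ≤ C * w x

lemma inner_ee_le (x : E3) (i : Fin 3) : |inner ℝ x (ee i)| ≤ ‖x‖ := by
  simpa [ee] using abs_real_inner_le_norm x (ee i)

lemma wt_WB (l : ℝ) : WB (1 + |l| + |l| * |l - 2|) (wt l) (wt l) := by
  have hp := wt_pos l
  have one' : ∀ i x, |(l * inner ℝ x (ee i)) • wt (l - 2) x| ≤ |l| * wt l x := by
    intro i x
    rw [smul_eq_mul, abs_mul, abs_mul, abs_of_pos (wt_pos _ x), mul_assoc]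
    gcongr
    rw [wt_step l x]
    have := wt_pos (l - 2) x
    gcongr
    nlinarith [inner_ee_le x i, sq_nonneg (‖x‖ - 1), norm_nonneg x]
  refine ⟨fun x => ?_, fun i x => ?_, fun i j x => ?_⟩
  · rw [abs_of_pos (hp x)]
    have := hp x
    have : 0 ≤ (|l| + |l| * |l - 2|) * wt l x := by positivity
    linarith
  · rw [DD_wt]
    refine (one' i x).trans ?_
    have := hp x
    have : 0 ≤ (1 + |l| * |l - 2|) * wt l x := by positivity
    linarith
  · rw [DD_wt, DD_smul (a := fun x => l * inner ℝ x (ee j)) (contDiff_const.mul (contDiff_id.inner ℝ contDiff_const)) ((wt_contDiff _).of_le (by norm_num)), DD_wt]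
    have e : DD (ee i) (fun x => l * inner ℝ x (ee j)) x = l * inner ℝ (ee i) (ee j) := by
      unfold DD
      have : HasFDerivAt (fun x : E3 => l * inner ℝ x (ee j)) (l • (innerSL ℝ (ee j))) x := by
        have := ((innerSL ℝ (ee j)).hasFDerivAt (x := x)).const_mul l
        refine this.congr_of_eventuallyEq (Filter.Eventually.of_forall fun y => ?_)
        simp only [innerSL_apply_apply, real_inner_comm]
      rw [this.fderiv]
      simp only [smul_apply, innerSL_apply_apply, real_inner_comm, smul_eq_mul]
    simp only [e]
    refine (abs_add_le _ _).trans ?_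
    have t1 : |(l * inner ℝ (ee i) (ee j)) • wt (l - 2) x| ≤ |l| * wt l x := by
      rw [smul_eq_mul, abs_mul, abs_mul, abs_of_pos (wt_pos _ x), mul_assoc]
      gcongr
      have h := inner_ee_le (ee i) j
      have h1 : ‖ee i‖ = 1 := by simp [ee]
      rw [h1] at h
      calc _ ≤ 1 * wt (l - 2) x := by
            have := wt_pos (l - 2) x
            gcongr
        _ ≤ _ := by rw [one_mul]; exact wt_mono l x
    have t2 : |(l * inner ℝ x (ee j)) • (((l - 2) * inner ℝ x (ee i)) • wt (l - 2 - 2) x)| ≤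
        |l| * |l - 2| * wt l x := by
      simp only [smul_eq_mul, abs_mul, abs_of_pos (wt_pos _ x)]
      have hw := wt_pos (l - 2 - 2) x
      calc _ = |l| * |l - 2| * ((|inner ℝ x (ee j)| * |inner ℝ x (ee i)|) * wt (l - 2 - 2) x) := by ring
        _ ≤ |l| * |l - 2| * ((‖x‖ * ‖x‖) * wt (l - 2 - 2) x) := by
            gcongr
            · exact inner_ee_le x j
            · exact inner_ee_le x i
        _ ≤ |l| * |l - 2| * wt (l - 2) x := by
            rw [wt_step (l - 2)]
            gcongr
            nlinarith
        _ ≤ _ := by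
            gcongr
            exact wt_mono l x
    have := hp x
    linarith

lemma WB.mul {M C : ℝ} {a b w : E3 → ℝ} (ha : WB M a (fun _ => 1)) (hb : WB C b w)
    (ca : ContDiff ℝ 2 a) (cb : ContDiff ℝ 2 b) (hM : 0 ≤ M) (hC : 0 ≤ C) (hw : ∀ x, 0 ≤ w x) :
    WB (4 * M * C) (fun x => a x • b x) w := by
  have gen : ∀ p q z : ℝ, 0 ≤ z → |p| ≤ M * 1 → |q| ≤ C * z → |p • q| ≤ M * C * z := by
    intro p q z hz hp hq
    rw [smul_eq_mul, abs_mul, mul_assoc]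
    rw [mul_one] at hp
    gcongr
  refine ⟨fun x => ?_, fun i x => ?_, fun i j x => ?_⟩
  · have := gen _ _ _ (hw x) (ha.zero x) (hb.zero x)
    have : 0 ≤ M * C * w x := mul_nonneg (by positivity) (hw x)
    linarith
  · rw [DD_smul (ca.of_le (by norm_num)) (cb.of_le (by norm_num))]
    have h1 := gen _ _ _ (hw x) (ha.one i x) (hb.zero x)
    have h2 := gen _ _ _ (hw x) (ha.zero x) (hb.one i x)
    have : 0 ≤ M * C * w x := mul_nonneg (by positivity) (hw x)
    refine (abs_add_le _ _).trans ?_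
    linarith
  · rw [DD2_smul ca cb]
    have h1 := gen _ _ _ (hw x) (ha.two i j x) (hb.zero x)
    have h2 := gen _ _ _ (hw x) (ha.one j x) (hb.one i x)
    have h3 := gen _ _ _ (hw x) (ha.one i x) (hb.one j x)
    have h4 := gen _ _ _ (hw x) (ha.zero x) (hb.two i j x)
    refine (abs_add_le _ _).trans ?_
    refine (add_le_add (abs_add_le _ _) (abs_add_le _ _)).trans ?_
    linarith

lemma DD_scale {F : Type*} [NormedAddCommGroup F] [NormedSpace ℝ F] (f : E3 → F) (c : ℝ) (v : E3)
    (hf : ContDiff ℝ 1 f) :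
    DD v (fun x => f (c • x)) = fun x => c • DD v f (c • x) := by
  ext x
  unfold DD
  have h1 : HasFDerivAt (fun x : E3 => c • x) (c • ContinuousLinearMap.id ℝ E3) x :=
    (c • ContinuousLinearMap.id ℝ E3).hasFDerivAt
  have h2 := ((hf.differentiable (by simp) (c • x)).hasFDerivAt).comp x h1
  have h3 : fderiv ℝ (fun x => f (c • x)) x = _ := h2.fderiv
  rw [h3]
  simp

lemma cutoff : ∃ M : ℝ, 0 ≤ M ∧ ∃ η : ℕ → E3 → ℝ, (∀ n, ContDiff ℝ 2 (η n)) ∧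
    (∀ n, HasCompactSupport (η n)) ∧ (∀ n, WB M (η n) (fun _ => 1)) ∧
    ∀ x, ∀ᶠ n in Filter.atTop, η n x = 1 := by
  let χ : ContDiffBump (0 : E3) := ⟨1, 2, by norm_num, by norm_num⟩
  have hχ : ContDiff ℝ 2 χ := χ.contDiff
  have hs : HasCompactSupport χ := χ.hasCompactSupport
  have b0 := hs.exists_bound_of_continuous hχ.continuous
  have b1 := fun i : Fin 3 => (DD_supp (v := ee i) hs).exists_bound_of_continuous
    (DD_cont (hχ.of_le (by norm_num)))
  have b2 := fun i j : Fin 3 => (DD_supp (v := ee i) (DD_supp (v := ee j) hs)).exists_bound_of_continuous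
    (DD_cont (DD_one hχ))
  obtain ⟨M0, h0⟩ := b0
  choose M1 h1 using b1
  choose M2 h2 using b2
  have n0 : 0 ≤ M0 := (norm_nonneg _).trans (h0 0)
  have n1 : ∀ i, 0 ≤ M1 i := fun i => (norm_nonneg _).trans (h1 i 0)
  have n2 : ∀ i j, 0 ≤ M2 i j := fun i j => (norm_nonneg _).trans (h2 i j 0)
  have s1 : 0 ≤ ∑ i, M1 i := Finset.sum_nonneg fun i _ => n1 i
  have s2 : 0 ≤ ∑ i, ∑ j, M2 i j := Finset.sum_nonneg fun i _ => Finset.sum_nonneg fun j _ => n2 i j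
  have l1 : ∀ i, M1 i ≤ ∑ i, M1 i := fun i => Finset.single_le_sum (fun i _ => n1 i) (Finset.mem_univ i)
  have l2 : ∀ i j, M2 i j ≤ ∑ i, ∑ j, M2 i j := fun i j =>
    (Finset.single_le_sum (f := fun j => M2 i j) (fun j _ => n2 i j) (Finset.mem_univ j)).trans
    (Finset.single_le_sum (f := fun i => ∑ j, M2 i j)
      (fun i _ => Finset.sum_nonneg fun j _ => n2 i j) (Finset.mem_univ i))
  have hc0 : ∀ n : ℕ, (0:ℝ) < 1 / ((n:ℝ) + 1) := fun n => by positivity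
  have hc1 : ∀ n : ℕ, 1 / ((n:ℝ) + 1) ≤ 1 := fun n => by
    rw [div_le_one (by positivity)]; linarith [(n.cast_nonneg : (0:ℝ) ≤ n)]
  refine ⟨M0 + ∑ i, M1 i + ∑ i, ∑ j, M2 i j, by positivity,
    fun n x => χ ((1 / ((n:ℝ) + 1)) • x), fun n => ?_, fun n => ?_, fun n => ?_, fun x => ?_⟩
  · exact hχ.comp (by fun_prop)
  · exact hs.comp_smul (hc0 n).ne'
  · set c := 1 / ((n:ℝ) + 1) with hc
    have a0 : 0 < c := hc0 n
    have a1 : c ≤ 1 := hc1 n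
    refine ⟨fun x => ?_, fun i x => ?_, fun i j x => ?_⟩
    · have := h0 (c • x)
      rw [Real.norm_eq_abs] at this
      linarith
    · rw [DD_scale _ c _ (hχ.of_le (by norm_num))]
      have := h1 i (c • x)
      rw [Real.norm_eq_abs] at this
      have t := l1 i
      simp only [smul_eq_mul, abs_mul, abs_of_pos a0]
      have : c * |DD (ee i) χ (c • x)| ≤ 1 * M1 i := by gcongr
      linarith
    · rw [DD_scale _ c _ (hχ.of_le (by norm_num)),
        DD_smul (a := fun _ => c) (f := fun x => DD (ee j) χ (c • x)) contDiff_const ((DD_one hχ).comp (by fun_prop)),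
        DD_scale _ c _ (DD_one hχ)]
      have := h2 i j (c • x)
      rw [Real.norm_eq_abs] at this
      have t := l2 i j
      have z : DD (ee i) (fun _ : E3 => c) x = 0 := by simp [DD]
      simp only [z, zero_mul, zero_add, smul_eq_mul, abs_mul, abs_of_pos a0]
      have : c * (c * |DD (ee i) (DD (ee j) χ) (c • x)|) ≤ 1 * (1 * M2 i j) := by gcongr
      linarith
  · obtain ⟨m, hm⟩ := exists_nat_ge ‖x‖
    filter_upwards [Filter.eventually_ge_atTop m] with n hn
    apply χ.one_of_mem_closedBall
    rw [mem_closedBall_zero_iff, norm_smul, Real.norm_of_nonneg (hc0 n).le]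
    change _ ≤ (1:ℝ)
    rw [one_div, inv_mul_le_iff₀ (by positivity)]
    have : (m:ℝ) ≤ n := by exact_mod_cast hn
    linarith

lemma N3 {ι κ F G H J : Type*} [Fintype ι] [Fintype κ] [NormedAddCommGroup F] [NormedAddCommGroup G]
    [NormedAddCommGroup H] [NormedAddCommGroup J] {f : E3 → F} {g : E3 → G} {h : ι → E3 → H}
    {m : κ → E3 → J} (K : ℝ) (hg : Continuous g) (hh : ∀ i, Continuous (h i))
    (hm : ∀ j, Continuous (m j))
    (hb : ∀ x, ‖f x‖ ≤ K * (‖g x‖ + ∑ i, ‖h i x‖ + ∑ j, ‖m j x‖)) :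
    eLpNorm f 2 volume ≤ ENNReal.ofReal K * (eLpNorm g 2 volume + ∑ i, eLpNorm (h i) 2 volume
      + ∑ j, eLpNorm (m j) 2 volume) := by
  have s0 : eLpNorm f 2 volume ≤ ENNReal.ofReal K *
      eLpNorm (fun x => ‖g x‖ + ∑ i, ‖h i x‖ + ∑ j, ‖m j x‖) 2 volume := by
    refine eLpNorm_le_mul_eLpNorm_of_ae_le_mul (Filter.Eventually.of_forall fun x => ?_) 2
    rw [Real.norm_of_nonneg (by positivity)]
    exact hb x
  refine s0.trans ?_
  gcongr
  have c1 : Continuous fun x => ∑ i, ‖h i x‖ := by fun_prop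
  have c2 : Continuous fun x => ∑ i, ‖m i x‖ := by fun_prop
  have c3 : Continuous fun x => ‖g x‖ + ∑ i, ‖h i x‖ := by fun_prop
  refine (eLpNorm_add_le c3.aestronglyMeasurable c2.aestronglyMeasurable (by norm_num)).trans ?_
  gcongr
  · refine (eLpNorm_add_le hg.norm.aestronglyMeasurable c1.aestronglyMeasurable (by norm_num)).trans ?_
    gcongr
    · rw [eLpNorm_norm]
    · have := eLpNorm_sum_le (s := Finset.univ) (f := fun i x => ‖h i x‖) (p := 2) (μ := (volume : Measure E3))
        (fun i _ => (hh i).norm.aestronglyMeasurable) (by norm_num)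
      simp only [eLpNorm_norm] at this
      refine le_trans (le_of_eq ?_) this
      congr 1; ext x; simp
  · have := eLpNorm_sum_le (s := Finset.univ) (f := fun i x => ‖m i x‖) (p := 2) (μ := (volume : Measure E3))
        (fun i _ => (hm i).norm.aestronglyMeasurable) (by norm_num)
    simp only [eLpNorm_norm] at this
    refine le_trans (le_of_eq ?_) this
    congr 1; ext x; simp

lemma fatou {V : ℕ → E3 → ℝ} {w : E3 → ℝ} {f : E3 → ℂ} (hV : ∀ n, Continuous (V n))
    (hf : Continuous f) (hl : ∀ x, ∀ᶠ n in Filter.atTop, V n x = w x) {K : ℝ≥0∞}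
    (hK : ∀ n, eLpNorm (fun x => V n x • f x) 2 volume ≤ K) :
    eLpNorm (fun x => w x • f x) 2 volume ≤ K := by
  refine (Lp.eLpNorm_lim_le_liminf_eLpNorm (f := fun n x => V n x • f x)
    (fun n => ((hV n).smul hf).aestronglyMeasurable) _
    (Filter.Eventually.of_forall fun x => ?_)).trans ?_
  · refine tendsto_const_nhds.congr' ?_
    filter_upwards [hl x] with n hn
    rw [hn]
  · refine (Filter.liminf_le_liminf (Filter.Eventually.of_forall hK)).trans ?_
    simp

/-- Cutoff weights. -/
lemma cutwt (l : ℝ) : ∃ K : ℝ, 0 ≤ K ∧ WB K (wt l) (wt l) ∧ ∃ V : ℕ → E3 → ℝ,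
    (∀ n, ContDiff ℝ 2 (V n)) ∧ (∀ n, HasCompactSupport (V n)) ∧ (∀ n, WB K (V n) (wt l)) ∧
    ∀ x, ∀ᶠ n in Filter.atTop, V n x = wt l x := by
  obtain ⟨M, hM, η, c, s, b, e⟩ := cutoff
  have hw := fun x => (wt_pos l x).le
  have hC : 0 ≤ 1 + |l| + |l| * |l - 2| := by positivity
  have mono : ∀ K K' a, K ≤ K' → WB K a (wt l) → WB K' a (wt l) := fun K K' a h hb =>
    ⟨fun x => (hb.zero x).trans (mul_le_mul_of_nonneg_right h (hw x)),
     fun i x => (hb.one i x).trans (mul_le_mul_of_nonneg_right h (hw x)),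
     fun i j x => (hb.two i j x).trans (mul_le_mul_of_nonneg_right h (hw x))⟩
  refine ⟨max (1 + |l| + |l| * |l - 2|) (4 * M * (1 + |l| + |l| * |l - 2|)),
    le_max_of_le_left hC, mono _ _ _ (le_max_left _ _) (wt_WB l), fun n x => η n x • wt l x,
    fun n => (c n).smul (wt_contDiff l), fun n => (s n).smul_right (f' := wt l), fun n =>
    mono _ _ _ (le_max_right _ _) ((b n).mul (wt_WB l) (c n) (wt_contDiff l) hM hC hw), fun x => ?_⟩
  filter_upwards [e x] with n hn
  simp [hn]

/-- The right-hand side. -/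
noncomputable def RR (l : ℝ) (φ : E3 → ℂ) : ℝ≥0∞ :=
  eLpNorm (fun x => wt l x • φ x) 2 volume + eLpNorm (fun x => wt l x • LL φ x) 2 volume

lemma wnorm (l : ℝ) (x : E3) (z : ℂ) : ‖wt l x • z‖ = wt l x * ‖z‖ := by
  rw [norm_smul, Real.norm_of_nonneg (wt_pos l x).le]

lemma wle {l K a : ℝ} {x : E3} (z : ℂ) (h : |a| ≤ K * wt l x) : ‖a • z‖ ≤ K * ‖wt l x • z‖ := by
  rw [wnorm, norm_smul, Real.norm_eq_abs, ← mul_assoc]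
  gcongr

lemma grad (l : ℝ) : ∃ C : ℝ≥0∞, C ≠ ⊤ ∧ ∀ φ : E3 → ℂ, ContDiff ℝ 2 φ → ∀ i,
    eLpNorm (fun x => wt l x • DD (ee i) φ x) 2 volume ≤ C * RR l φ := by
  obtain ⟨K, hK, -, V, cV, sV, bV, eV⟩ := cutwt l
  refine ⟨7 * ENNReal.ofReal K, ENNReal.mul_ne_top (by simp) (by simp), fun φ hφ i => ?_⟩
  refine fatou (fun n => (cV n).continuous) (DD_cont (hφ.of_le (by norm_num))) eV fun n => ?_
  refine (core1 ((cV n).of_le (by norm_num)) hφ (sV n) i).trans ?_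
  have b1 : eLpNorm (fun x => V n x • φ x) 2 volume ≤ ENNReal.ofReal K *
      eLpNorm (fun x => wt l x • φ x) 2 volume :=
    eLpNorm_le_mul_eLpNorm_of_ae_le_mul
      (Filter.Eventually.of_forall fun x => wle _ ((bV n).zero x)) 2
  have b2 : eLpNorm (fun x => V n x • LL φ x) 2 volume ≤ ENNReal.ofReal K *
      eLpNorm (fun x => wt l x • LL φ x) 2 volume :=
    eLpNorm_le_mul_eLpNorm_of_ae_le_mul
      (Filter.Eventually.of_forall fun x => wle _ ((bV n).zero x)) 2
  have b3 : ∀ i, eLpNorm (fun x => DD (ee i) (V n) x • φ x) 2 volume ≤ ENNReal.ofReal K *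
      eLpNorm (fun x => wt l x • φ x) 2 volume := fun i =>
    eLpNorm_le_mul_eLpNorm_of_ae_le_mul
      (Filter.Eventually.of_forall fun x => wle _ ((bV n).one i x)) 2
  refine (add_le_add (add_le_add b1 b2) (mul_le_mul_right (Finset.sum_le_sum fun i _ => b3 i) 2)).trans ?_
  unfold RR
  simp only [Finset.sum_const, Finset.card_univ, Fintype.card_fin, nsmul_eq_mul]
  generalize eLpNorm (fun x => wt l x • φ x) 2 volume = A
  generalize eLpNorm (fun x => wt l x • LL φ x) 2 volume = B
  generalize ENNReal.ofReal K = k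
  push_cast
  have : 7 * k * (A + B) = k * A + k * B + 2 * (3 * (k * A)) + 6 * (k * B) := by ring
  rw [this]
  exact le_self_add

lemma hess (l : ℝ) : ∃ C : ℝ≥0∞, C ≠ ⊤ ∧ ∀ φ : E3 → ℂ, ContDiff ℝ 2 φ → ∀ i j,
    eLpNorm (fun x => wt l x • DD (ee i) (DD (ee j) φ) x) 2 volume ≤ C * RR l φ := by
  obtain ⟨K, hK, -, V, cV, sV, bV, eV⟩ := cutwt l
  obtain ⟨C, hC, hg⟩ := grad l
  refine ⟨ENNReal.ofReal (1 + 2 * K) * (1 + 3 * C + ENNReal.ofReal (3 * K) * (1 + 3 * C + 1)),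
    by finiteness, fun φ hφ i j => ?_⟩
  have cw := (wt_contDiff l).continuous
  have cφ := hφ.continuous
  have cD : ∀ i, Continuous (DD (ee i) φ) := fun i => DD_cont (hφ.of_le (by norm_num))
  have cL := LL_cont hφ
  refine fatou (fun n => (cV n).continuous) (DD_cont (DD_one hφ)) eV fun n => ?_
  set v : E3 → ℂ := fun x => V n x • φ x with hv
  have cv : ContDiff ℝ 2 v := (cV n).smul hφ
  have sA : eLpNorm (fun x => wt l x • φ x) 2 volume ≤ RR l φ := le_self_add
  have sB : eLpNorm (fun x => wt l x • LL φ x) 2 volume ≤ RR l φ := le_add_self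
  have sG : ∑ i, eLpNorm (fun x => wt l x • DD (ee i) φ x) 2 volume ≤ 3 * (C * RR l φ) := by
    refine (Finset.sum_le_sum fun i _ => hg φ hφ i).trans ?_
    simp
  have s1 : eLpNorm (LL v) 2 volume ≤ ENNReal.ofReal (3 * K) * ((1 + 3 * C + 1) * RR l φ) := by
    refine (N3 (κ := Fin 1) (g := fun x => wt l x • φ x) (h := fun i x => wt l x • DD (ee i) φ x)
      (m := fun _ x => wt l x • LL φ x) (3 * K) (by fun_prop) (fun i => by fun_prop)
      (fun i => by fun_prop) fun x => ?_).trans ?_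
    · have e : LL v x = (∑ i, DD (ee i) (DD (ee i) (V n)) x • φ x)
          + (2:ℝ) • (∑ i, DD (ee i) (V n) x • DD (ee i) φ x) + V n x • LL φ x := by
        simp only [LL, hv]
        simp only [DD2_smul (cV n) hφ, Fin.sum_univ_three, smul_add, two_smul]
        abel
      rw [e]
      have t1 : ‖∑ i, DD (ee i) (DD (ee i) (V n)) x • φ x‖ ≤ ∑ i : Fin 3, K * ‖wt l x • φ x‖ :=
        norm_sum_le_of_le _ fun i _ => wle _ ((bV n).two i i x)
      have t2 : ‖∑ i, DD (ee i) (V n) x • DD (ee i) φ x‖ ≤ ∑ i : Fin 3, K * ‖wt l x • DD (ee i) φ x‖ :=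
        norm_sum_le_of_le _ fun i _ => wle _ ((bV n).one i x)
      have t3 : ‖V n x • LL φ x‖ ≤ K * ‖wt l x • LL φ x‖ := wle _ ((bV n).zero x)
      refine (norm_add_le _ _).trans ((add_le_add (norm_add_le _ _) le_rfl).trans ?_)
      rw [norm_smul, Real.norm_of_nonneg (by norm_num : (0:ℝ) ≤ 2)]
      rw [← Finset.mul_sum] at t2
      simp only [Finset.sum_const, Finset.card_univ, Fintype.card_fin, nsmul_eq_mul] at t1 ⊢
      push_cast at t1 ⊢
      have p1 : 0 ≤ K * ∑ i, ‖wt l x • DD (ee i) φ x‖ := by positivity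
      have p2 : 0 ≤ K * ‖wt l x • LL φ x‖ := by positivity
      linarith
    · gcongr
      simp only [Finset.sum_const, Finset.card_univ, Fintype.card_fin, nsmul_eq_mul]
      push_cast
      rw [one_mul]
      refine (add_le_add (add_le_add sA sG) sB).trans (le_of_eq (by ring))
  refine (N3 (κ := Fin 1) (g := fun x => wt l x • φ x) (h := fun i x => wt l x • DD (ee i) φ x)
      (m := fun _ x => DD (ee i) (DD (ee j) v) x) (1 + 2 * K) (by fun_prop) (fun i => by fun_prop)
      (fun _ => DD_cont (DD_one cv)) fun x => ?_).trans ?_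
  · have e : V n x • DD (ee i) (DD (ee j) φ) x = DD (ee i) (DD (ee j) v) x
        - DD (ee i) (DD (ee j) (V n)) x • φ x - DD (ee j) (V n) x • DD (ee i) φ x
        - DD (ee i) (V n) x • DD (ee j) φ x := by
      simp only [hv]
      rw [DD2_smul (cV n) hφ]
      simp only [Complex.real_smul]
      ring
    rw [e]
    have t1 := wle (φ x) ((bV n).two i j x)
    have t2 := wle (DD (ee i) φ x) ((bV n).one j x)
    have t3 := wle (DD (ee j) φ x) ((bV n).one i x)
    have q : ∀ i, ‖wt l x • DD (ee i) φ x‖ ≤ ∑ i, ‖wt l x • DD (ee i) φ x‖ := fun i =>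
      Finset.single_le_sum (f := fun i => ‖wt l x • DD (ee i) φ x‖) (fun i _ => norm_nonneg _)
        (Finset.mem_univ i)
    have t2' := t2.trans (mul_le_mul_of_nonneg_left (q i) hK)
    have t3' := t3.trans (mul_le_mul_of_nonneg_left (q j) hK)
    refine (norm_sub_le _ _).trans ((add_le_add ((norm_sub_le _ _).trans
      (add_le_add (norm_sub_le _ _) le_rfl)) le_rfl).trans ?_)
    simp only [Finset.sum_const, Finset.card_univ, Fintype.card_fin, nsmul_eq_mul]
    push_cast
    have p1 : 0 ≤ ∑ i, ‖wt l x • DD (ee i) φ x‖ := by positivity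
    have p2 : 0 ≤ ‖wt l x • φ x‖ := by positivity
    have p3 : 0 ≤ K * ‖DD (ee i) (DD (ee j) v) x‖ := by positivity
    have p4 : 0 ≤ K * ‖wt l x • φ x‖ := by positivity
    linarith
  · rw [mul_assoc]
    gcongr
    simp only [Finset.sum_const, Finset.card_univ, Fintype.card_fin, nsmul_eq_mul]
    push_cast
    rw [one_mul]
    refine (add_le_add (add_le_add sA sG) ((core2 cv (smul_supp (sV n)) i j).trans s1)).trans
      (le_of_eq (by ring))

lemma lap_eq {φ : E3 → ℂ} (hφ : ContDiff ℝ 2 φ) : lap φ = LL φ := by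
  ext x
  simp only [lap, LL]
  exact Finset.sum_congr rfl fun i _ => iter2 hφ x _ _

lemma pair_le (g : Fin 3 → Fin 3 → ℝ) (hg : ∀ i j, 0 ≤ g i j) (i j : Fin 3) :
    g i j ≤ ∑ p : Fin 3 × Fin 3, g p.1 p.2 :=
  Finset.single_le_sum (s := Finset.univ) (f := fun p : Fin 3 × Fin 3 => g p.1 p.2)
    (fun p _ => hg p.1 p.2) (Finset.mem_univ (i, j))

lemma first1 (l : ℝ) : ∃ C : ℝ≥0∞, C ≠ ⊤ ∧ ∀ φ : E3 → ℂ, ContDiff ℝ 2 φ →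
    eLpNorm (fun x => ‖iteratedFDeriv ℝ 1 (fun x => wt l x • φ x) x‖) 2 volume ≤ C * RR l φ := by
  obtain ⟨K, hK, hw, -⟩ := cutwt l
  obtain ⟨C, hC, hg⟩ := grad l
  obtain ⟨C', hC', hh⟩ := hess l
  refine ⟨ENNReal.ofReal (3 * K) * (1 + 3 * C), by finiteness, fun φ hφ => ?_⟩
  have cw := (wt_contDiff l).continuous
  have cφ := hφ.continuous
  have cD : ∀ i, Continuous (DD (ee i) φ) := fun i => DD_cont (hφ.of_le (by norm_num))
  have cH : ∀ i j, Continuous (DD (ee i) (DD (ee j) φ)) := fun i j => DD_cont (DD_one hφ)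
  have sA : eLpNorm (fun x => wt l x • φ x) 2 volume ≤ RR l φ := le_self_add
  have sG : ∑ i, eLpNorm (fun x => wt l x • DD (ee i) φ x) 2 volume ≤ 3 * (C * RR l φ) := by
    refine (Finset.sum_le_sum fun i _ => hg φ hφ i).trans ?_
    simp
  have cu : ContDiff ℝ 2 (fun x => wt l x • φ x) := (wt_contDiff l).smul hφ
  have q : ∀ x i, ‖wt l x • DD (ee i) φ x‖ ≤ ∑ i, ‖wt l x • DD (ee i) φ x‖ := fun x i =>
      Finset.single_le_sum (f := fun i => ‖wt l x • DD (ee i) φ x‖) (fun i _ => norm_nonneg _)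
        (Finset.mem_univ i)
  · refine (N3 (κ := Fin 0) (J := ℂ) (g := fun x => wt l x • φ x) (h := fun i x => wt l x • DD (ee i) φ x)
      (m := fun _ x => 0) (3 * K) (by fun_prop) (fun i => by fun_prop)
      (fun _ => by fun_prop) fun x => ?_).trans ?_
    · rw [norm_norm]
      refine (iter1_le _ _).trans ?_
      have : ∀ i, ‖DD (ee i) (fun x => wt l x • φ x) x‖ ≤ K * (‖wt l x • φ x‖ +
          ∑ i, ‖wt l x • DD (ee i) φ x‖) := by
        intro i
        rw [DD_smul ((wt_contDiff l).of_le (by norm_num)) (hφ.of_le (by norm_num))]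
        refine (norm_add_le_of_le (wle _ (hw.one i x)) (wle _ (hw.zero x))).trans ?_
        rw [← mul_add]
        gcongr
        exact q x i
      refine (Finset.sum_le_sum fun i _ => this i).trans (le_of_eq ?_)
      simp
      ring
    · rw [mul_assoc]
      gcongr
      simp only [Finset.univ_eq_empty, Finset.sum_empty, add_zero]
      exact (add_le_add sA sG).trans (le_of_eq (by ring))

lemma first2 (l : ℝ) : ∃ C : ℝ≥0∞, C ≠ ⊤ ∧ ∀ φ : E3 → ℂ, ContDiff ℝ 2 φ →
    eLpNorm (fun x => ‖iteratedFDeriv ℝ 2 (fun x => wt l x • φ x) x‖) 2 volume ≤ C * RR l φ := by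
  obtain ⟨K, hK, hw, -⟩ := cutwt l
  obtain ⟨C, hC, hg⟩ := grad l
  obtain ⟨C', hC', hh⟩ := hess l
  refine ⟨ENNReal.ofReal (9 * K) * (1 + 6 * C + 9 * C'), by finiteness, fun φ hφ => ?_⟩
  have cw := (wt_contDiff l).continuous
  have cφ := hφ.continuous
  have cD : ∀ i, Continuous (DD (ee i) φ) := fun i => DD_cont (hφ.of_le (by norm_num))
  have cH : ∀ i j, Continuous (DD (ee i) (DD (ee j) φ)) := fun i j => DD_cont (DD_one hφ)
  have sA : eLpNorm (fun x => wt l x • φ x) 2 volume ≤ RR l φ := le_self_add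
  have sG : ∑ i, eLpNorm (fun x => wt l x • DD (ee i) φ x) 2 volume ≤ 3 * (C * RR l φ) := by
    refine (Finset.sum_le_sum fun i _ => hg φ hφ i).trans ?_
    simp
  have sH : ∑ p : Fin 3 × Fin 3, eLpNorm (fun x => wt l x • DD (ee p.1) (DD (ee p.2) φ) x) 2 volume
      ≤ 9 * (C' * RR l φ) := by
    refine (Finset.sum_le_sum (g := fun _ => C' * RR l φ) fun i _ => hh φ hφ _ _).trans ?_
    rw [Finset.sum_const, Finset.card_univ, Fintype.card_prod, Fintype.card_fin, nsmul_eq_mul]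
    norm_num
  have cu : ContDiff ℝ 2 (fun x => wt l x • φ x) := (wt_contDiff l).smul hφ
  have q : ∀ x i, ‖wt l x • DD (ee i) φ x‖ ≤ ∑ i, ‖wt l x • DD (ee i) φ x‖ := fun x i =>
      Finset.single_le_sum (f := fun i => ‖wt l x • DD (ee i) φ x‖) (fun i _ => norm_nonneg _)
        (Finset.mem_univ i)
  have q2 : ∀ x i j, ‖wt l x • DD (ee i) (DD (ee j) φ) x‖ ≤
      ∑ p : Fin 3 × Fin 3, ‖wt l x • DD (ee p.1) (DD (ee p.2) φ) x‖ := by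
    intro x i j
    have := pair_le (fun i j => ‖wt l x • DD (ee i) (DD (ee j) φ) x‖) (fun i j => norm_nonneg _) i j
    exact this
  · refine (N3 (g := fun x => wt l x • φ x) (h := fun (i : Fin 3 × Fin 2) x => wt l x • DD (ee i.1) φ x)
      (m := fun (p : Fin 3 × Fin 3) x => wt l x • DD (ee p.1) (DD (ee p.2) φ) x) (9 * K)
      (by fun_prop) (fun i => by fun_prop) (fun _ => by fun_prop) fun x => ?_).trans ?_
    · rw [norm_norm]
      refine (iter2_le cu _).trans ?_
      have : ∀ i j, ‖DD (ee i) (DD (ee j) (fun x => wt l x • φ x)) x‖ ≤ K * (‖wt l x • φ x‖ +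
          ∑ i : Fin 3 × Fin 2, ‖wt l x • DD (ee i.1) φ x‖ +
          ∑ p : Fin 3 × Fin 3, ‖wt l x • DD (ee p.1) (DD (ee p.2) φ) x‖) := by
        intro i j
        rw [DD2_smul (wt_contDiff l) hφ]
        refine (norm_add_le_of_le (norm_add_le_of_le (wle _ (hw.two i j x)) (wle _ (hw.one j x)))
          (norm_add_le_of_le (wle _ (hw.one i x)) (wle _ (hw.zero x)))).trans ?_
        rw [Fintype.sum_prod_type' (f := fun i (_ : Fin 2) => ‖wt l x • DD (ee i) φ x‖)]
        simp only [Finset.sum_const, Finset.card_univ, Fintype.card_fin, ← Finset.smul_sum]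
        have a1 := mul_le_mul_of_nonneg_left (q x i) hK
        have a2 := mul_le_mul_of_nonneg_left (q x j) hK
        have a3 := mul_le_mul_of_nonneg_left (q2 x i j) hK
        rw [nsmul_eq_mul]
        push_cast
        linarith
      refine (Finset.sum_le_sum fun i _ => Finset.sum_le_sum fun j _ => this i j).trans (le_of_eq ?_)
      simp only [Finset.sum_const, Finset.card_univ, Fintype.card_fin, nsmul_eq_mul]
      push_cast
      ring
    · rw [mul_assoc]
      gcongr
      rw [Fintype.sum_prod_type' (f := fun i (_ : Fin 2) =>
        eLpNorm (fun x => wt l x • DD (ee i) φ x) 2 volume)]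
      simp only [Finset.sum_const, Finset.card_univ, Fintype.card_fin, ← Finset.smul_sum]
      rw [nsmul_eq_mul]
      push_cast
      exact (add_le_add (add_le_add sA (mul_le_mul_right sG 2)) sH).trans (le_of_eq (by ring))

lemma first (l : ℝ) : ∃ C : ℝ≥0∞, C ≠ ⊤ ∧ ∀ φ : E3 → ℂ, ContDiff ℝ 2 φ →
    H2norm (fun x => wt l x • φ x) ≤ C * RR l φ := by
  obtain ⟨C, hC, h1⟩ := first1 l
  obtain ⟨C', hC', h2⟩ := first2 l
  refine ⟨1 + C + C', by finiteness, fun φ hφ => ?_⟩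
  unfold H2norm
  rw [add_mul, add_mul, one_mul]
  exact add_le_add (add_le_add le_self_add (h1 φ hφ)) (h2 φ hφ)

lemma second (l : ℝ) : ∃ C : ℝ≥0∞, C ≠ ⊤ ∧ ∀ φ : E3 → ℂ, ContDiff ℝ 2 φ →
    RR l φ ≤ C * H2norm (fun x => wt l x • φ x) := by
  obtain ⟨K, hK, hw, -⟩ := cutwt (-l)
  refine ⟨1 + ENNReal.ofReal (6 * K), by finiteness, fun φ hφ => ?_⟩
  set u := fun x => wt l x • φ x with hu
  have cu : ContDiff ℝ 2 u := (wt_contDiff l).smul hφ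
  have hφu : φ = fun x => wt (-l) x • u x := by
    ext1 x
    simp only [hu, smul_smul, wt_inv, one_smul]
  have i1 : Continuous (iteratedFDeriv ℝ 1 u) := cu.continuous_iteratedFDeriv (by norm_num)
  have i2 : Continuous (iteratedFDeriv ℝ 2 u) := cu.continuous_iteratedFDeriv (by norm_num)
  unfold RR
  rw [add_mul, one_mul]
  refine add_le_add ?_ ?_
  · unfold H2norm
    rw [add_assoc]
    exact le_self_add
  · refine (N3 (ι := Fin 1) (κ := Fin 1) (g := u) (h := fun _ x => ‖iteratedFDeriv ℝ 1 u x‖)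
      (m := fun _ x => ‖iteratedFDeriv ℝ 2 u x‖) (6 * K) cu.continuous (fun _ => i1.norm)
      (fun _ => i2.norm) fun x => ?_).trans ?_
    · have bd : ∀ (a : ℝ) (z : ℂ), |a| ≤ K * wt (-l) x → ‖wt l x • a • z‖ ≤ K * ‖z‖ := by
        intro a z h
        rw [wnorm, norm_smul, Real.norm_eq_abs, ← mul_assoc]
        gcongr
        calc wt l x * |a| ≤ wt l x * (K * wt (-l) x) := by
              have := wt_pos l x
              gcongr
          _ = K * (wt (-l) x * wt l x) := by ring
          _ = K := by rw [wt_inv, mul_one]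
      have : ∀ i, ‖wt l x • DD (ee i) (DD (ee i) φ) x‖ ≤ K * (‖u x‖ + 2 * ‖iteratedFDeriv ℝ 1 u x‖ +
          ‖iteratedFDeriv ℝ 2 u x‖) := by
        intro i
        conv_lhs => rw [hφu]
        rw [DD2_smul (wt_contDiff _) cu]
        simp only [smul_add]
        refine (norm_add_le_of_le (norm_add_le_of_le (bd _ _ (hw.two i i x)) (bd _ _ (hw.one i x)))
          (norm_add_le_of_le (bd _ _ (hw.one i x)) (bd _ _ (hw.zero x)))).trans ?_
        have a1 := mul_le_mul_of_nonneg_left (norm_DD_le u i x) hK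
        have a2 := mul_le_mul_of_nonneg_left (norm_DD2_le cu i i x) hK
        linarith
      simp only [LL, Finset.smul_sum]
      refine (norm_sum_le_of_le _ fun i _ => this i).trans ?_
      simp only [Finset.sum_const, Finset.card_univ, Fintype.card_fin, nsmul_eq_mul, norm_norm]
      push_cast
      have p1 : 0 ≤ K * ‖u x‖ := by positivity
      have p2 : 0 ≤ K * ‖iteratedFDeriv ℝ 2 u x‖ := by positivity
      linarith
    · simp [H2norm]

/-- For any real `l`, `‖φ‖_{H^{2,l}} ≃ ‖⟨x⟩^l φ‖_{L²} + ‖⟨x⟩^l Δφ‖_{L²}`. -/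
theorem stmt9 (l : ℝ) :
    ∃ C : ℝ≥0∞, C ≠ ⊤ ∧ ∀ φ : E3 → ℂ, ContDiff ℝ 2 φ →
      (H2wnorm l φ ≤
        C * (eLpNorm (fun x => (((1 + ‖x‖ ^ 2) ^ (l / 2) : ℝ) : ℂ) * φ x) 2 volume
          + eLpNorm (fun x => (((1 + ‖x‖ ^ 2) ^ (l / 2) : ℝ) : ℂ) * lap φ x) 2 volume)) ∧
      eLpNorm (fun x => (((1 + ‖x‖ ^ 2) ^ (l / 2) : ℝ) : ℂ) * φ x) 2 volume
          + eLpNorm (fun x => (((1 + ‖x‖ ^ 2) ^ (l / 2) : ℝ) : ℂ) * lap φ x) 2 volume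
        ≤ C * H2wnorm l φ := by
  obtain ⟨C, hC, h1⟩ := first l
  obtain ⟨C', hC', h2⟩ := second l
  refine ⟨C + C', by finiteness, fun φ hφ => ?_⟩
  have e : ∀ f : E3 → ℂ, (fun x => (((1 + ‖x‖ ^ 2) ^ (l / 2) : ℝ) : ℂ) * f x) =
      fun x => wt l x • f x := by
    intro f; ext1 x; rw [Complex.real_smul, wt]
  unfold H2wnorm
  rw [lap_eq hφ, e, e]
  exact ⟨(h1 φ hφ).trans (mul_le_mul_left le_self_add _), (h2 φ hφ).trans (mul_le_mul_left le_add_self _)⟩
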